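/- Relative Extension: Assume L is countable. For every prime saturated BQL_CD-theory Γ: if Γ ⊬_{[-1]} φ→ψ, then there exists a prime saturated BQL_CD-theory Σ such that Γ ≺ Σ, φ ∈ Σ and ψ ∉ Σ, where Γ ≺ Σ means that for all sentences α, β: α→β ∈ Γ and α ∈ Σ imply β ∈ Σ. -/

import Mathlib

universe u v

namespace BQL

structure Signature : Type 1 where
  Const : Type
  Func : Type
  arityF : Func → ℕ
  Rel : Type
  arityR : Rel → ℕ

inductive Term (L : Signature) : Type
  | var : ℕ → Term L
  | const : L.Const → Term L
  | func : (f : L.Func) → (Fin (L.arityF f) → Term L) → Term L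

inductive Formula (L : Signature) : Type
  | top : Formula L
  | bot : Formula L
  | rel : (R : L.Rel) → (Fin (L.arityR R) → Term L) → Formula L
  | and : Formula L → Formula L → Formula L
  | or : Formula L → Formula L → Formula L
  | imp : Formula L → Formula L → Formula L
  | all : Formula L → Formula L
  | ex : Formula L → Formula L

variable {L : Signature}

namespace Term

/-- Shift all (free) variables of a term up by one. -/
def shiftUp : Term L → Term L
  | var n => var (n + 1)
  | const c => const c
  | func f ts => func f fun i => (ts i).shiftUp

/-- Apply a simultaneous substitution to a term. -/
def applySub (σ : ℕ → Term L) : Term L → Term L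
  | var n => σ n
  | const c => const c
  | func f ts => func f fun i => (ts i).applySub σ

/-- All variables of the term are `< k`. -/
def ClosedAt : Term L → ℕ → Prop
  | var n, k => n < k
  | const _, _ => True
  | func _ ts, k => ∀ i, (ts i).ClosedAt k

/-- A closed term. -/
def Closed (t : Term L) : Prop := t.ClosedAt 0

/-- The constant `c` occurs in the term. -/
def OccC (c : L.Const) : Term L → Prop
  | var _ => False
  | const d => d = c
  | func _ ts => ∃ i, (ts i).OccC c

end Term

/-- Lift a substitution under a binder. -/
def liftSub (σ : ℕ → Term L) : ℕ → Term L
  | 0 => .var 0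
  | n + 1 => (σ n).shiftUp

namespace Formula

/-- Apply a simultaneous substitution to a formula. -/
def applySub (σ : ℕ → Term L) : Formula L → Formula L
  | top => top
  | bot => bot
  | rel R ts => rel R fun i => (ts i).applySub σ
  | and φ ψ => and (φ.applySub σ) (ψ.applySub σ)
  | or φ ψ => or (φ.applySub σ) (ψ.applySub σ)
  | imp φ ψ => imp (φ.applySub σ) (ψ.applySub σ)
  | all φ => all (φ.applySub (liftSub σ))
  | ex φ => ex (φ.applySub (liftSub σ))

/-- All free variables of the formula are `< k`. -/
def ClosedAt : Formula L → ℕ → Prop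
  | top, _ => True
  | bot, _ => True
  | rel _ ts, k => ∀ i, (ts i).ClosedAt k
  | and φ ψ, k => φ.ClosedAt k ∧ ψ.ClosedAt k
  | or φ ψ, k => φ.ClosedAt k ∧ ψ.ClosedAt k
  | imp φ ψ, k => φ.ClosedAt k ∧ ψ.ClosedAt k
  | all φ, k => φ.ClosedAt (k + 1)
  | ex φ, k => φ.ClosedAt (k + 1)

/-- A sentence: a formula with no free variables. -/
def Sentence (φ : Formula L) : Prop := φ.ClosedAt 0

/-- The constant `c` occurs in the formula. -/
def OccC (c : L.Const) : Formula L → Prop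
  | top => False
  | bot => False
  | rel _ ts => ∃ i, (ts i).OccC c
  | and φ ψ => φ.OccC c ∨ ψ.OccC c
  | or φ ψ => φ.OccC c ∨ ψ.OccC c
  | imp φ ψ => φ.OccC c ∨ ψ.OccC c
  | all φ => φ.OccC c
  | ex φ => φ.OccC c

/-- The formula contains no occurrence of `∨` and no occurrence of `∃`. -/
def NoOrEx : Formula L → Prop
  | top => True
  | bot => True
  | rel _ _ => True
  | and φ ψ => φ.NoOrEx ∧ ψ.NoOrEx
  | or _ _ => False
  | imp φ ψ => φ.NoOrEx ∧ ψ.NoOrEx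
  | all φ => φ.NoOrEx
  | ex _ => False

end Formula

/-- Substitute the term `t` for the variable `v₀` (lowering the other variables). -/
def subst0 (φ : Formula L) (t : Term L) : Formula L :=
  φ.applySub fun n => match n with | 0 => t | n + 1 => .var n

/-- `□ⁿφ`, where `□φ` abbreviates `⊤ → φ`. -/
def boxN : ℕ → Formula L → Formula L
  | 0, φ => φ
  | n + 1, φ => .imp .top (boxN n φ)

/-- The conjunction of a finite list of formulas (`⋀∅ = ⊤`). -/
def conjL : List (Formula L) → Formula L
  | [] => .top
  | [φ] => φ
  | φ :: ψ :: l => .and φ (conjL (ψ :: l))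

/-- The language `L⁺`, obtained from `L` by adding countably many fresh constants `aᵢ`. -/
def Signature.plus (L : Signature) : Signature where
  Const := L.Const ⊕ ℕ
  Func := L.Func
  arityF := L.arityF
  Rel := L.Rel
  arityR := L.arityR

/-- The fresh constant `aᵢ` of `L⁺`. -/
def aconst (L : Signature) (i : ℕ) : Term L.plus := .const (Sum.inr i)

/-- Embedding of `L`-terms into `L⁺`-terms. -/
def Term.emb : Term L → Term L.plus
  | .var n => .var n
  | .const c => .const (Sum.inl c)
  | .func f ts => .func f fun i => (ts i).emb

/-- Embedding of `L`-formulas into `L⁺`-formulas. -/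
def Formula.emb : Formula L → Formula L.plus
  | .top => .top
  | .bot => .bot
  | .rel R ts => .rel R fun i => (ts i).emb
  | .and φ ψ => .and φ.emb ψ.emb
  | .or φ ψ => .or φ.emb ψ.emb
  | .imp φ ψ => .imp φ.emb ψ.emb
  | .all φ => .all φ.emb
  | .ex φ => .ex φ.emb

/-- The fresh constant `aᵢ` occurs in no member of `Γ`. -/
def FreshIn (i : ℕ) (Γ : Set (Formula L.plus)) : Prop :=
  ∀ ψ ∈ Γ, ¬ ψ.OccC (Sum.inr i)

/-- A Kripke `L`-model (the frame conditions are packaged in `KModel.Proper`). -/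
structure KModel (L : Signature) : Type (u + 1) where
  W : Type u
  acc : W → W → Prop
  D : Type u
  interpC : L.Const → D
  interpF : (f : L.Func) → (Fin (L.arityF f) → D) → D
  interpR : (R : L.Rel) → W → Set (Fin (L.arityR R) → D)

/-- The conditions on an `L`-model: nonempty set of worlds, transitive accessibility
relation, nonempty domain, and the persistence constraint. -/
def KModel.Proper (M : KModel.{u} L) : Prop :=
  Nonempty M.W ∧ Nonempty M.D ∧ Transitive M.acc ∧
    ∀ (R : L.Rel) (w u' : M.W), M.acc w u' → M.interpR R w ⊆ M.interpR R u'

/-- Prepend a value to a valuation. -/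
def vcons {α : Sort*} (d : α) (ρ : ℕ → α) : ℕ → α
  | 0 => d
  | n + 1 => ρ n

/-- Denotation of a term. -/
def Term.eval (M : KModel.{u} L) (ρ : ℕ → M.D) : Term L → M.D
  | .var n => ρ n
  | .const c => M.interpC c
  | .func f ts => M.interpF f fun i => (ts i).eval M ρ

/-- The satisfaction relation `w ⊩ φ(ā)`. -/
def Sat (M : KModel.{u} L) : M.W → (ℕ → M.D) → Formula L → Prop
  | _, _, .top => True
  | _, _, .bot => False
  | w, ρ, .rel R ts => (fun i => (ts i).eval M ρ) ∈ M.interpR R w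
  | w, ρ, .and φ ψ => Sat M w ρ φ ∧ Sat M w ρ ψ
  | w, ρ, .or φ ψ => Sat M w ρ φ ∨ Sat M w ρ ψ
  | w, ρ, .imp φ ψ => ∀ u', M.acc w u' → Sat M u' ρ φ → Sat M u' ρ ψ
  | w, ρ, .all φ => ∀ d, Sat M w (vcons d ρ) φ
  | w, ρ, .ex φ => ∃ d, Sat M w (vcons d ρ) φ

/-- Satisfaction of a sentence (under every valuation). -/
def SatS (M : KModel.{u} L) (w : M.W) (φ : Formula L) : Prop := ∀ ρ, Sat M w ρ φ

/-- `Γ ⊨ φ`: truth is preserved at every reflexive world of every `L`-model. -/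
def Models (Γ : Set (Formula L)) (φ : Formula L) : Prop :=
  ∀ M : KModel.{u} L, M.Proper → ∀ w : M.W, M.acc w w →
    (∀ ψ ∈ Γ, SatS M w ψ) → SatS M w φ

/-- `Γ : Δ ⊨ φ`: for every `L`-model, every reflexive world `w` and every world `u ≻ w`:
if `w ⊩ Γ` and `u ⊩ Δ` then `u ⊩ φ`. -/
def ModelsCtx (Γ Δ : Set (Formula L)) (φ : Formula L) : Prop :=
  ∀ M : KModel.{u} L, M.Proper → ∀ w u' : M.W, M.acc w w → M.acc w u' →
    (∀ ψ ∈ Γ, SatS M w ψ) → (∀ ψ ∈ Δ, SatS M u' ψ) → SatS M u' φ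

end BQL

namespace BQL

/-- `PrfN L n Γ Δ φ` formalizes `Γ : Δ ⊢_{[n-1]} φ`: there is a proof of `φ` in the
system `NBQL_CD[n-1]` (so `PrfN L 0` is the system `NBQL_CD`, i.e. `⊢_{[-1]}`, which
has no modus ponens at all) whose open assumptions all belong to `Γ ∪ Δ` and in which
every open assumption occurring unsafely (i.e. in the right main subproof of an
application of the restricted modus ponens rule) belongs to `Γ`.  The restricted
modus ponens rule of `NBQL_CD[n-1]` requires its right main subproof to lie entirely
within `NBQL_CD[m-1]` for some `m < n`. -/
inductive PrfN (L : Signature) :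
    ℕ → Set (Formula L.plus) → Set (Formula L.plus) → Formula L.plus → Prop
  | hyp {n Γ Δ φ} : φ ∈ Γ ∪ Δ → φ.Sentence → PrfN L n Γ Δ φ
  | weaken {n Γ Γ' Δ Δ' φ} : Γ ⊆ Γ' → Δ ⊆ Δ' → PrfN L n Γ Δ φ → PrfN L n Γ' Δ' φ
  | topIntro {n Γ Δ} : PrfN L n Γ Δ .top
  | botElim {n Γ Δ φ} : φ.Sentence → PrfN L n Γ Δ .bot → PrfN L n Γ Δ φ
  | andIntro {n Γ Δ φ ψ} : PrfN L n Γ Δ φ → PrfN L n Γ Δ ψ → PrfN L n Γ Δ (.and φ ψ)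
  | andElimL {n Γ Δ φ ψ} : PrfN L n Γ Δ (.and φ ψ) → PrfN L n Γ Δ φ
  | andElimR {n Γ Δ φ ψ} : PrfN L n Γ Δ (.and φ ψ) → PrfN L n Γ Δ ψ
  | orIntroL {n Γ Δ φ ψ} : ψ.Sentence → PrfN L n Γ Δ φ → PrfN L n Γ Δ (.or φ ψ)
  | orIntroR {n Γ Δ φ ψ} : φ.Sentence → PrfN L n Γ Δ ψ → PrfN L n Γ Δ (.or φ ψ)
  | orElim {n Γ Δ φ ψ χ} : PrfN L n Γ Δ (.or φ ψ) → PrfN L n Γ (insert φ Δ) χ →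
      PrfN L n Γ (insert ψ Δ) χ → PrfN L n Γ Δ χ
  | impIntro {n Γ Δ φ ψ} : φ.Sentence → PrfN L n Γ (insert φ Δ) ψ →
      PrfN L n Γ Δ (.imp φ ψ)
  | impElim {n m Γ Δ φ ψ} : m < n → PrfN L n Γ Δ φ → PrfN L m Γ ∅ (.imp φ ψ) →
      PrfN L n Γ Δ ψ
  | intTrans {n Γ Δ φ ψ χ} : PrfN L n Γ Δ (.imp φ ψ) → PrfN L n Γ Δ (.imp ψ χ) →
      PrfN L n Γ Δ (.imp φ χ)
  | intAndIntro {n Γ Δ φ ψ χ} : PrfN L n Γ Δ (.imp φ ψ) → PrfN L n Γ Δ (.imp φ χ) →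
      PrfN L n Γ Δ (.imp φ (.and ψ χ))
  | intOrElim {n Γ Δ φ ψ χ} : PrfN L n Γ Δ (.imp φ χ) → PrfN L n Γ Δ (.imp ψ χ) →
      PrfN L n Γ Δ (.imp (.or φ ψ) χ)
  | intAllIntro {n Γ Δ φ ψ} : φ.Sentence → PrfN L n Γ Δ (.all (.imp φ ψ)) →
      PrfN L n Γ Δ (.imp φ (.all ψ))
  | intExElim {n Γ Δ φ ψ} : ψ.Sentence → PrfN L n Γ Δ (.all (.imp φ ψ)) →
      PrfN L n Γ Δ (.imp (.ex φ) ψ)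
  | allIntro {n Γ Δ Γ' Δ' φ} {i : ℕ} : Γ' ⊆ Γ → Δ' ⊆ Δ → FreshIn i Γ' → FreshIn i Δ' →
      ¬ φ.OccC (Sum.inr i) → PrfN L n Γ' Δ' (subst0 φ (aconst L i)) →
      PrfN L n Γ Δ (.all φ)
  | allElim {n Γ Δ φ} {t : Term L.plus} : t.Closed → PrfN L n Γ Δ (.all φ) →
      PrfN L n Γ Δ (subst0 φ t)
  | cd {n Γ Δ φ ψ} : φ.Sentence → PrfN L n Γ Δ (.all (.or φ ψ)) →
      PrfN L n Γ Δ (.or φ (.all ψ))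
  | exIntro {n Γ Δ φ} {t : Term L.plus} : t.Closed → (Formula.ex φ).Sentence →
      PrfN L n Γ Δ (subst0 φ t) → PrfN L n Γ Δ (.ex φ)
  | exElim {n Γ Δ Γ' Δ' φ ψ} {i : ℕ} : Γ' ⊆ Γ → Δ' ⊆ Δ → FreshIn i Γ' → FreshIn i Δ' →
      ¬ φ.OccC (Sum.inr i) → ¬ ψ.OccC (Sum.inr i) → PrfN L n Γ Δ (.ex φ) →
      PrfN L n Γ' (insert (subst0 φ (aconst L i)) Δ') ψ → PrfN L n Γ Δ ψ

/-- `Γ ⊢_{[-1]} φ`: there is a proof of `φ` from `Γ` in `NBQL_CD`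
(the system `NBQL_CD^r` with `→`-Elim deleted). -/
def PrvB (L : Signature) (Γ : Set (Formula L.plus)) (φ : Formula L.plus) : Prop :=
  PrfN L 0 Γ ∅ φ

end BQL

namespace BQL

/-- A prime saturated `BQL_CD`-theory: a set of `L⁺`-sentences which is consistent,
closed under `NBQL_CD` (`⊢_{[-1]}`), and has the disjunction, existence and totality
properties. -/
def PST (L : Signature) (Γ : Set (Formula L.plus)) : Prop :=
  (∀ φ ∈ Γ, Formula.Sentence φ) ∧
  Formula.bot ∉ Γ ∧
  (∀ φ : Formula L.plus, φ.Sentence → PrvB L Γ φ → φ ∈ Γ) ∧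
  (∀ φ ψ : Formula L.plus, Formula.or φ ψ ∈ Γ → φ ∈ Γ ∨ ψ ∈ Γ) ∧
  (∀ φ : Formula L.plus, Formula.ex φ ∈ Γ →
    ∃ t : Term L.plus, t.Closed ∧ subst0 φ t ∈ Γ) ∧
  (∀ φ : Formula L.plus, φ.ClosedAt 1 →
    (∀ t : Term L.plus, t.Closed → subst0 φ t ∈ Γ) → Formula.all φ ∈ Γ)

/-- The accessibility relation of the canonical model:
`Γ ≺ Δ` iff for all `α`, `β`: if `α → β ∈ Γ` and `α ∈ Δ` then `β ∈ Δ`. -/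
def canAcc (L : Signature) (Γ Δ : Set (Formula L.plus)) : Prop :=
  ∀ α β : Formula L.plus, Formula.imp α β ∈ Γ → α ∈ Δ → β ∈ Δ

/-- The canonical model: worlds are the prime saturated `BQL_CD`-theories, the domain
is the set of closed `L⁺`-terms, every constant denotes itself, function symbols act
syntactically, and `⟨t₁,...,tₙ⟩ ∈ |R|(Γ)` iff `R(t₁,...,tₙ) ∈ Γ`. -/
def CModel (L : Signature) : KModel.{0} L.plus where
  W := {Γ : Set (Formula L.plus) // PST L Γ}
  acc Γ Δ := canAcc L Γ.1 Δ.1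
  D := {t : Term L.plus // t.Closed}
  interpC c := ⟨Term.const c, trivial⟩
  interpF f ts := ⟨Term.func f fun i => (ts i).1, fun i => (ts i).2⟩
  interpR R Γ := {ts | Formula.rel R (fun i => (ts i).1) ∈ Γ.1}

end BQL

namespace BQL

/-! ### Substitution for variables and replacement of constants -/

namespace Term

variable {L : Signature}

theorem ClosedAt.mono {t : Term L} {k l : ℕ} (h : t.ClosedAt k) (hkl : k ≤ l) :
    t.ClosedAt l := by
  induction t with
  | var n => exact lt_of_lt_of_le h hkl
  | const c => trivial
  | func f ts ih => exact fun i => ih i (h i)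

theorem closedAt_shiftUp {t : Term L} {k : ℕ} : t.shiftUp.ClosedAt (k + 1) ↔ t.ClosedAt k := by
  induction t with
  | var n => exact Nat.succ_lt_succ_iff
  | const c => exact Iff.rfl
  | func f ts ih => exact forall_congr' ih

theorem ClosedAt.applySub_eq_self {t : Term L} {k : ℕ} {σ : ℕ → Term L} (h : t.ClosedAt k)
    (hσ : ∀ n < k, σ n = var n) : t.applySub σ = t := by
  induction t with
  | var n => exact hσ n h
  | const c => rfl
  | func f ts ih => exact congrArg (func f) (funext fun i => ih i (h i))

theorem Closed.shiftUp_eq_self {t : Term L} (h : t.Closed) : t.shiftUp = t := by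
  induction t with
  | var n => exact absurd h (Nat.not_lt_zero n)
  | const c => rfl
  | func f ts ih => exact congrArg (func f) (funext fun i => ih i (h i))

theorem ClosedAt.applySub {t : Term L} {k l : ℕ} {σ : ℕ → Term L} (h : t.ClosedAt k)
    (hσ : ∀ n < k, (σ n).ClosedAt l) : (t.applySub σ).ClosedAt l := by
  induction t with
  | var n => exact hσ n h
  | const c => trivial
  | func f ts ih => exact fun i => ih i (h i)

theorem ClosedAt.of_applySub {t : Term L} {k l : ℕ} {σ : ℕ → Term L}
    (h : (t.applySub σ).ClosedAt l) (hσ : ∀ n, (σ n).ClosedAt l → n < k) : t.ClosedAt k := by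
  induction t with
  | var n => exact hσ n h
  | const c => trivial
  | func f ts ih => exact fun i => ih i (h i)

/-- Replace every constant by a term. -/
def replC (σ : L.Const → Term L) : Term L → Term L
  | var n => var n
  | const c => σ c
  | func f ts => func f fun i => (ts i).replC σ

theorem replC_const (t : Term L) : t.replC const = t := by
  induction t with
  | var n => rfl
  | const c => rfl
  | func f ts ih => exact congrArg (func f) (funext ih)

theorem replC_congr {t : Term L} {σ τ : L.Const → Term L} (h : ∀ c, t.OccC c → σ c = τ c) :
    t.replC σ = t.replC τ := by
  induction t with
  | var n => rfl
  | const c => exact h c rfl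
  | func f ts ih =>
    exact congrArg (func f) (funext fun i => ih i fun c hc => h c ⟨i, hc⟩)

theorem ClosedAt.replC {t : Term L} {k : ℕ} {σ : L.Const → Term L} (h : t.ClosedAt k)
    (hσ : ∀ c, (σ c).Closed) : (t.replC σ).ClosedAt k := by
  induction t with
  | var n => exact h
  | const c => exact ClosedAt.mono (hσ c) (Nat.zero_le k)
  | func f ts ih => exact fun i => ih i (h i)

theorem replC_shiftUp {t : Term L} {σ : L.Const → Term L} (hσ : ∀ c, (σ c).Closed) :
    t.shiftUp.replC σ = (t.replC σ).shiftUp := by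
  induction t with
  | var n => rfl
  | const c => exact (hσ c).shiftUp_eq_self.symm
  | func f ts ih => exact congrArg (func f) (funext ih)

theorem replC_applySub {t : Term L} {σ : L.Const → Term L} (hσ : ∀ c, (σ c).Closed)
    (τ : ℕ → Term L) :
    (t.applySub τ).replC σ = (t.replC σ).applySub fun n => (τ n).replC σ := by
  induction t with
  | var n => rfl
  | const c =>
    exact (ClosedAt.applySub_eq_self (hσ c) fun n hn => absurd hn (Nat.not_lt_zero n)).symm
  | func f ts ih => exact congrArg (func f) (funext ih)

theorem finite_setOf_occC (t : Term L) : {c | t.OccC c}.Finite := by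
  induction t with
  | var n => exact Set.finite_empty
  | const d => exact (Set.finite_singleton d).subset fun c hc => Eq.symm hc
  | func f ts ih =>
    refine (Set.finite_iUnion ih).subset ?_
    rintro c ⟨i, hi⟩
    exact Set.mem_iUnion.2 ⟨i, hi⟩

/-- Terms as well-founded trees. -/
def toWType : Term L → WType (α := (ℕ ⊕ L.Const) ⊕ L.Func)
    fun s => Fin (Sum.elim (fun _ => 0) L.arityF s)
  | var n => ⟨.inl (.inl n), Fin.elim0⟩
  | const c => ⟨.inl (.inr c), Fin.elim0⟩
  | func f ts => ⟨.inr f, fun i => (ts i).toWType⟩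

theorem toWType_injective : Function.Injective (toWType (L := L)) := by
  intro s
  induction s with
  | var n =>
    intro t h
    cases t <;> cases h
    rfl
  | const c =>
    intro t h
    cases t <;> cases h
    rfl
  | func f ts ih =>
    intro t h
    cases t <;> injection h with hf hts <;> cases hf
    exact congrArg (func f) (funext fun i => ih i (congrFun (eq_of_heq hts) i))

instance [Countable L.Const] [Countable L.Func] : Countable (Term L) := by
  have := Encodable.ofCountable L.Const
  have := Encodable.ofCountable L.Func
  exact toWType_injective.countable

end Term

section

variable {L : Signature}

theorem liftSub_eq_var {k : ℕ} {σ : ℕ → Term L} (hσ : ∀ n < k, σ n = .var n) :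
    ∀ n < k + 1, liftSub σ n = .var n
  | 0, _ => rfl
  | n + 1, hn => congrArg Term.shiftUp (hσ n (Nat.lt_of_succ_lt_succ hn))

theorem closedAt_liftSub {k l : ℕ} {σ : ℕ → Term L} (hσ : ∀ n < k, (σ n).ClosedAt l) :
    ∀ n < k + 1, (liftSub σ n).ClosedAt (l + 1)
  | 0, _ => Nat.succ_pos l
  | n + 1, hn => Term.closedAt_shiftUp.2 (hσ n (Nat.lt_of_succ_lt_succ hn))

theorem lt_of_closedAt_liftSub {k l : ℕ} {σ : ℕ → Term L}
    (hσ : ∀ n, (σ n).ClosedAt l → n < k) : ∀ n, (liftSub σ n).ClosedAt (l + 1) → n < k + 1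
  | 0, _ => Nat.succ_pos k
  | n + 1, hn => Nat.succ_lt_succ (hσ n (Term.closedAt_shiftUp.1 hn))

theorem replC_liftSub {σ : L.Const → Term L} (hσ : ∀ c, (σ c).Closed) (τ : ℕ → Term L) :
    (fun n => (liftSub τ n).replC σ) = liftSub fun n => (τ n).replC σ := by
  funext n
  cases n with
  | zero => rfl
  | succ n => exact Term.replC_shiftUp hσ

end

namespace Formula

variable {L : Signature}

theorem ClosedAt.applySub_eq_self {φ : Formula L} {k : ℕ} {σ : ℕ → Term L} (h : φ.ClosedAt k)
    (hσ : ∀ n < k, σ n = .var n) : φ.applySub σ = φ := by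
  induction φ generalizing k σ with
  | top | bot => rfl
  | rel R ts => exact congrArg (rel R) (funext fun i => (h i).applySub_eq_self hσ)
  | and φ ψ ih₁ ih₂ | or φ ψ ih₁ ih₂ | imp φ ψ ih₁ ih₂ =>
    exact congrArg₂ _ (ih₁ h.1 hσ) (ih₂ h.2 hσ)
  | all φ ih | ex φ ih => exact congrArg _ (ih (k := k + 1) h (liftSub_eq_var hσ))

theorem ClosedAt.applySub {φ : Formula L} {k l : ℕ} {σ : ℕ → Term L} (h : φ.ClosedAt k)
    (hσ : ∀ n < k, (σ n).ClosedAt l) : (φ.applySub σ).ClosedAt l := by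
  induction φ generalizing k l σ with
  | top | bot => trivial
  | rel R ts => exact fun i => (h i).applySub hσ
  | and φ ψ ih₁ ih₂ | or φ ψ ih₁ ih₂ | imp φ ψ ih₁ ih₂ => exact ⟨ih₁ h.1 hσ, ih₂ h.2 hσ⟩
  | all φ ih | ex φ ih => exact ih (k := k + 1) (l := l + 1) h (closedAt_liftSub hσ)

theorem ClosedAt.of_applySub {φ : Formula L} {k l : ℕ} {σ : ℕ → Term L}
    (h : (φ.applySub σ).ClosedAt l) (hσ : ∀ n, (σ n).ClosedAt l → n < k) : φ.ClosedAt k := by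
  induction φ generalizing k l σ with
  | top | bot => trivial
  | rel R ts => exact fun i => (h i).of_applySub hσ
  | and φ ψ ih₁ ih₂ | or φ ψ ih₁ ih₂ | imp φ ψ ih₁ ih₂ => exact ⟨ih₁ h.1 hσ, ih₂ h.2 hσ⟩
  | all φ ih | ex φ ih => exact ih (k := k + 1) (l := l + 1) h (lt_of_closedAt_liftSub hσ)

/-- Replace every constant by a term; no renaming of bound variables takes place, so this is
meant for closed terms. -/
def replC (σ : L.Const → Term L) : Formula L → Formula L
  | top => top
  | bot => bot
  | rel R ts => rel R fun i => (ts i).replC σ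
  | and φ ψ => and (φ.replC σ) (ψ.replC σ)
  | or φ ψ => or (φ.replC σ) (ψ.replC σ)
  | imp φ ψ => imp (φ.replC σ) (ψ.replC σ)
  | all φ => all (φ.replC σ)
  | ex φ => ex (φ.replC σ)

theorem replC_const (φ : Formula L) : φ.replC .const = φ := by
  induction φ with
  | top | bot => rfl
  | rel R ts => exact congrArg (rel R) (funext fun i => (ts i).replC_const)
  | and φ ψ ih₁ ih₂ | or φ ψ ih₁ ih₂ | imp φ ψ ih₁ ih₂ => exact congrArg₂ _ ih₁ ih₂
  | all φ ih | ex φ ih => exact congrArg _ ih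

theorem replC_congr {φ : Formula L} {σ τ : L.Const → Term L}
    (h : ∀ c, φ.OccC c → σ c = τ c) : φ.replC σ = φ.replC τ := by
  induction φ with
  | top | bot => rfl
  | rel R ts =>
    exact congrArg (rel R) (funext fun i => Term.replC_congr fun c hc => h c ⟨i, hc⟩)
  | and φ ψ ih₁ ih₂ =>
    exact congrArg₂ and (ih₁ fun c hc => h c (.inl hc)) (ih₂ fun c hc => h c (.inr hc))
  | or φ ψ ih₁ ih₂ =>
    exact congrArg₂ or (ih₁ fun c hc => h c (.inl hc)) (ih₂ fun c hc => h c (.inr hc))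
  | imp φ ψ ih₁ ih₂ =>
    exact congrArg₂ imp (ih₁ fun c hc => h c (.inl hc)) (ih₂ fun c hc => h c (.inr hc))
  | all φ ih | ex φ ih => exact congrArg _ (ih h)

theorem ClosedAt.replC {φ : Formula L} {k : ℕ} {σ : L.Const → Term L} (h : φ.ClosedAt k)
    (hσ : ∀ c, (σ c).Closed) : (φ.replC σ).ClosedAt k := by
  induction φ generalizing k with
  | top | bot => trivial
  | rel R ts => exact fun i => (h i).replC hσ
  | and φ ψ ih₁ ih₂ | or φ ψ ih₁ ih₂ | imp φ ψ ih₁ ih₂ => exact ⟨ih₁ h.1, ih₂ h.2⟩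
  | all φ ih | ex φ ih => exact ih (k := k + 1) h

theorem replC_applySub {φ : Formula L} {σ : L.Const → Term L} (hσ : ∀ c, (σ c).Closed)
    (τ : ℕ → Term L) :
    (φ.applySub τ).replC σ = (φ.replC σ).applySub fun n => (τ n).replC σ := by
  induction φ generalizing τ with
  | top | bot => rfl
  | rel R ts => exact congrArg (rel R) (funext fun i => Term.replC_applySub hσ τ)
  | and φ ψ ih₁ ih₂ | or φ ψ ih₁ ih₂ | imp φ ψ ih₁ ih₂ =>
    exact congrArg₂ _ (ih₁ τ) (ih₂ τ)
  | all φ ih | ex φ ih =>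
    exact congrArg _ ((ih (liftSub τ)).trans (by rw [replC_liftSub hσ]))

theorem finite_setOf_occC (φ : Formula L) : {c | φ.OccC c}.Finite := by
  induction φ with
  | top | bot => exact Set.finite_empty
  | rel R ts =>
    refine (Set.finite_iUnion fun i => (ts i).finite_setOf_occC).subset ?_
    rintro c ⟨i, hi⟩
    exact Set.mem_iUnion.2 ⟨i, hi⟩
  | and φ ψ ih₁ ih₂ | or φ ψ ih₁ ih₂ | imp φ ψ ih₁ ih₂ => exact ih₁.union ih₂
  | all φ ih | ex φ ih => exact ih

/-- The number of immediate subformulas of a formula with the given root symbol. -/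
def shapeArity : ((Σ R : L.Rel, Fin (L.arityR R) → Term L) ⊕ Fin 2) ⊕ (Fin 3 ⊕ Fin 2) → ℕ :=
  Sum.elim (fun _ => 0) (Sum.elim (fun _ => 2) fun _ => 1)

/-- Formulas as well-founded trees. -/
def toWType : Formula L → WType fun s => Fin (shapeArity (L := L) s)
  | top => ⟨.inl (.inr 0), Fin.elim0⟩
  | bot => ⟨.inl (.inr 1), Fin.elim0⟩
  | rel R ts => ⟨.inl (.inl ⟨R, ts⟩), Fin.elim0⟩
  | and φ ψ => ⟨.inr (.inl 0), ![φ.toWType, ψ.toWType]⟩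
  | or φ ψ => ⟨.inr (.inl 1), ![φ.toWType, ψ.toWType]⟩
  | imp φ ψ => ⟨.inr (.inl 2), ![φ.toWType, ψ.toWType]⟩
  | all φ => ⟨.inr (.inr 0), ![φ.toWType]⟩
  | ex φ => ⟨.inr (.inr 1), ![φ.toWType]⟩

theorem toWType_injective : Function.Injective (toWType (L := L)) := by
  intro φ
  induction φ with
  | top | bot | rel R ts =>
    intro ψ h
    cases ψ <;> cases h
    rfl
  | and φ₁ φ₂ ih₁ ih₂ | or φ₁ φ₂ ih₁ ih₂ | imp φ₁ φ₂ ih₁ ih₂ =>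
    intro ψ h
    cases ψ <;> injection h with hs h <;> cases hs
    exact congrArg₂ _ (ih₁ (congrFun h 0)) (ih₂ (congrFun h 1))
  | all φ ih | ex φ ih =>
    intro ψ h
    cases ψ <;> injection h with hs h <;> cases hs
    exact congrArg _ (ih (congrFun h 0))

instance [Countable L.Const] [Countable L.Func] [Countable L.Rel] : Countable (Formula L) := by
  have := Encodable.ofCountable ((Σ R : L.Rel, Fin (L.arityR R) → Term L))
  exact toWType_injective.countable

end Formula

section

variable {L : Signature}

theorem Formula.Sentence.subst0_eq_self {φ : Formula L} (h : φ.Sentence) (t : Term L) :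
    subst0 φ t = φ :=
  Formula.ClosedAt.applySub_eq_self h fun n hn => absurd hn (Nat.not_lt_zero n)

theorem sentence_subst0 {φ : Formula L} {t : Term L} (h : φ.ClosedAt 1) (ht : t.Closed) :
    (subst0 φ t).Sentence :=
  h.applySub fun n hn => by
    obtain rfl := Nat.lt_one_iff.1 hn
    exact ht

theorem closedAt_one_of_subst0 {φ : Formula L} {t : Term L} (h : (subst0 φ t).Sentence) :
    φ.ClosedAt 1 :=
  Formula.ClosedAt.of_applySub h fun n hn => by
    cases n with
    | zero => exact Nat.one_pos
    | succ n => exact absurd hn (Nat.not_lt_zero n)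

theorem replC_subst0 {σ : L.Const → Term L} (hσ : ∀ c, (σ c).Closed) (φ : Formula L)
    (t : Term L) : (subst0 φ t).replC σ = subst0 (φ.replC σ) (t.replC σ) := by
  refine (Formula.replC_applySub hσ _).trans
    (congrArg (Formula.applySub · (φ.replC σ)) (funext fun n => ?_))
  cases n <;> rfl

theorem exists_fresh (φ ψ : Formula L.plus) :
    ∃ i : ℕ, ¬ φ.OccC (Sum.inr i) ∧ ¬ ψ.OccC (Sum.inr i) := by
  have hfin := (φ.finite_setOf_occC.union ψ.finite_setOf_occC).preimage
    (f := (Sum.inr : ℕ → L.Const ⊕ ℕ)) Sum.inr_injective.injOn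
  obtain ⟨i, hi⟩ := hfin.exists_notMem
  exact ⟨i, fun h => hi (.inl h), fun h => hi (.inr h)⟩

theorem exists_replC_update {σ : L.plus.Const → Term L.plus} (hσ : ∀ c, (σ c).Closed)
    {t : Term L.plus} (ht : t.Closed) (i : ℕ) :
    ∃ τ : L.plus.Const → Term L.plus, (∀ c, (τ c).Closed) ∧
      (∀ φ : Formula L.plus, ¬ φ.OccC (Sum.inr i) → φ.replC τ = φ.replC σ) ∧
      ∀ φ : Formula L.plus, ¬ φ.OccC (Sum.inr i) →
        (subst0 φ (aconst L i)).replC τ = subst0 (φ.replC σ) t := by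
  classical
  let c₀ : L.plus.Const := Sum.inr i
  have hc : ∀ c, (if c = c₀ then t else σ c).Closed := fun c => by
    split_ifs
    exacts [ht, hσ c]
  have heq (φ : Formula L.plus) (hi : ¬ φ.OccC c₀) :
      φ.replC (fun c => if c = c₀ then t else σ c) = φ.replC σ :=
    Formula.replC_congr fun c hc => if_neg fun (h : c = c₀) => hi (h ▸ hc)
  refine ⟨_, hc, heq, fun φ hi => ?_⟩
  rw [replC_subst0 hc, heq φ hi]
  exact congrArg _ (if_pos rfl)

instance [Countable L.Const] : Countable L.plus.Const :=
  inferInstanceAs (Countable (L.Const ⊕ ℕ))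

instance [Countable L.Func] : Countable L.plus.Func := ‹_›

instance [Countable L.Rel] : Countable L.plus.Rel := ‹_›

end

/-! ### Compactness -/

theorem exists_finite_of_subset_insert {α : Type*} {a : α} {S F : Set α} (hF : F.Finite)
    (h : F ⊆ insert a S) : ∃ G ⊆ S, G.Finite ∧ F ⊆ insert a G :=
  ⟨F \ {a}, fun _ hx => (h hx.1).resolve_left hx.2, hF.subset Set.sdiff_subset,
    fun x hx => (em (x = a)).imp id fun hxa => ⟨hx, hxa⟩⟩

/-- A derivation uses only finitely many assumptions. -/
theorem PrfN.exists_finite {L : Signature} {n : ℕ} {Γ Δ : Set (Formula L.plus)}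
    {χ : Formula L.plus} (h : PrfN L n Γ Δ χ) :
    ∃ G D, G ⊆ Γ ∧ D ⊆ Δ ∧ G.Finite ∧ D.Finite ∧ PrfN L n G D χ := by
  induction h with
  | @hyp n Γ Δ φ hm hs =>
    rcases hm with hm | hm
    · exact ⟨{φ}, ∅, Set.singleton_subset_iff.2 hm, Set.empty_subset _, Set.finite_singleton _,
        Set.finite_empty, .hyp (.inl rfl) hs⟩
    · exact ⟨∅, {φ}, Set.empty_subset _, Set.singleton_subset_iff.2 hm, Set.finite_empty,
        Set.finite_singleton _, .hyp (.inr rfl) hs⟩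
  | weaken h₁ h₂ _ ih =>
    obtain ⟨G, D, hG, hD, fG, fD, h⟩ := ih
    exact ⟨G, D, hG.trans h₁, hD.trans h₂, fG, fD, h⟩
  | topIntro => exact ⟨∅, ∅, by simp, by simp, by simp, by simp, .topIntro⟩
  | botElim hs _ ih =>
    obtain ⟨G, D, hG, hD, fG, fD, h⟩ := ih
    exact ⟨G, D, hG, hD, fG, fD, .botElim hs h⟩
  | andElimL _ ih =>
    obtain ⟨G, D, hG, hD, fG, fD, h⟩ := ih
    exact ⟨G, D, hG, hD, fG, fD, .andElimL h⟩
  | andElimR _ ih =>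
    obtain ⟨G, D, hG, hD, fG, fD, h⟩ := ih
    exact ⟨G, D, hG, hD, fG, fD, .andElimR h⟩
  | orIntroL hs _ ih =>
    obtain ⟨G, D, hG, hD, fG, fD, h⟩ := ih
    exact ⟨G, D, hG, hD, fG, fD, .orIntroL hs h⟩
  | orIntroR hs _ ih =>
    obtain ⟨G, D, hG, hD, fG, fD, h⟩ := ih
    exact ⟨G, D, hG, hD, fG, fD, .orIntroR hs h⟩
  | intAllIntro hs _ ih =>
    obtain ⟨G, D, hG, hD, fG, fD, h⟩ := ih
    exact ⟨G, D, hG, hD, fG, fD, .intAllIntro hs h⟩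
  | intExElim hs _ ih =>
    obtain ⟨G, D, hG, hD, fG, fD, h⟩ := ih
    exact ⟨G, D, hG, hD, fG, fD, .intExElim hs h⟩
  | allElim ht _ ih =>
    obtain ⟨G, D, hG, hD, fG, fD, h⟩ := ih
    exact ⟨G, D, hG, hD, fG, fD, .allElim ht h⟩
  | cd hs _ ih =>
    obtain ⟨G, D, hG, hD, fG, fD, h⟩ := ih
    exact ⟨G, D, hG, hD, fG, fD, .cd hs h⟩
  | exIntro ht hs _ ih =>
    obtain ⟨G, D, hG, hD, fG, fD, h⟩ := ih
    exact ⟨G, D, hG, hD, fG, fD, .exIntro ht hs h⟩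
  | andIntro _ _ ih₁ ih₂ =>
    obtain ⟨G, D, hG, hD, fG, fD, h⟩ := ih₁
    obtain ⟨G', D', hG', hD', fG', fD', h'⟩ := ih₂
    exact ⟨G ∪ G', D ∪ D', Set.union_subset hG hG', Set.union_subset hD hD', fG.union fG',
      fD.union fD', .andIntro (.weaken Set.subset_union_left Set.subset_union_left h)
        (.weaken Set.subset_union_right Set.subset_union_right h')⟩
  | intTrans _ _ ih₁ ih₂ =>
    obtain ⟨G, D, hG, hD, fG, fD, h⟩ := ih₁
    obtain ⟨G', D', hG', hD', fG', fD', h'⟩ := ih₂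
    exact ⟨G ∪ G', D ∪ D', Set.union_subset hG hG', Set.union_subset hD hD', fG.union fG',
      fD.union fD', .intTrans (.weaken Set.subset_union_left Set.subset_union_left h)
        (.weaken Set.subset_union_right Set.subset_union_right h')⟩
  | intAndIntro _ _ ih₁ ih₂ =>
    obtain ⟨G, D, hG, hD, fG, fD, h⟩ := ih₁
    obtain ⟨G', D', hG', hD', fG', fD', h'⟩ := ih₂
    exact ⟨G ∪ G', D ∪ D', Set.union_subset hG hG', Set.union_subset hD hD', fG.union fG',
      fD.union fD', .intAndIntro (.weaken Set.subset_union_left Set.subset_union_left h)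
        (.weaken Set.subset_union_right Set.subset_union_right h')⟩
  | intOrElim _ _ ih₁ ih₂ =>
    obtain ⟨G, D, hG, hD, fG, fD, h⟩ := ih₁
    obtain ⟨G', D', hG', hD', fG', fD', h'⟩ := ih₂
    exact ⟨G ∪ G', D ∪ D', Set.union_subset hG hG', Set.union_subset hD hD', fG.union fG',
      fD.union fD', .intOrElim (.weaken Set.subset_union_left Set.subset_union_left h)
        (.weaken Set.subset_union_right Set.subset_union_right h')⟩
  | impElim hmn _ _ ih₁ ih₂ =>
    obtain ⟨G, D, hG, hD, fG, fD, h⟩ := ih₁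
    obtain ⟨G', D', hG', hD', fG', -, h'⟩ := ih₂
    exact ⟨G ∪ G', D, Set.union_subset hG hG', hD, fG.union fG', fD,
      .impElim hmn (.weaken Set.subset_union_left subset_rfl h)
        (.weaken Set.subset_union_right hD' h')⟩
  | impIntro hs _ ih =>
    obtain ⟨G, D, hG, hD, fG, fD, h⟩ := ih
    obtain ⟨E, hE, fE, hDE⟩ := exists_finite_of_subset_insert fD hD
    exact ⟨G, E, hG, hE, fG, fE, .impIntro hs (.weaken subset_rfl hDE h)⟩
  | orElim _ _ _ ih₁ ih₂ ih₃ =>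
    obtain ⟨G₁, D₁, hG₁, hD₁, fG₁, fD₁, h₁⟩ := ih₁
    obtain ⟨G₂, D₂, hG₂, hD₂, fG₂, fD₂, h₂⟩ := ih₂
    obtain ⟨G₃, D₃, hG₃, hD₃, fG₃, fD₃, h₃⟩ := ih₃
    obtain ⟨E₂, hE₂, fE₂, hDE₂⟩ := exists_finite_of_subset_insert fD₂ hD₂
    obtain ⟨E₃, hE₃, fE₃, hDE₃⟩ := exists_finite_of_subset_insert fD₃ hD₃
    refine ⟨G₁ ∪ (G₂ ∪ G₃), D₁ ∪ (E₂ ∪ E₃), Set.union_subset hG₁ (Set.union_subset hG₂ hG₃),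
      Set.union_subset hD₁ (Set.union_subset hE₂ hE₃), fG₁.union (fG₂.union fG₃),
      fD₁.union (fE₂.union fE₃),
      .orElim (.weaken Set.subset_union_left Set.subset_union_left h₁)
        (.weaken (fun x hx => .inr (.inl hx))
          (hDE₂.trans (Set.insert_subset_insert fun x hx => .inr (.inl hx))) h₂)
        (.weaken (fun x hx => .inr (.inr hx))
          (hDE₃.trans (Set.insert_subset_insert fun x hx => .inr (.inr hx))) h₃)⟩
  | allIntro hΓ hΔ fΓ fΔ hφ _ ih =>
    obtain ⟨G, D, hG, hD, fG, fD, h⟩ := ih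
    exact ⟨G, D, hG.trans hΓ, hD.trans hΔ, fG, fD, .allIntro subset_rfl subset_rfl
      (fun x hx => fΓ x (hG hx)) (fun x hx => fΔ x (hD hx)) hφ h⟩
  | exElim hΓ hΔ fΓ fΔ hφ hψ _ _ ih₁ ih₂ =>
    obtain ⟨G₁, D₁, hG₁, hD₁, fG₁, fD₁, h₁⟩ := ih₁
    obtain ⟨G₂, D₂, hG₂, hD₂, fG₂, fD₂, h₂⟩ := ih₂
    obtain ⟨E, hE, fE, hDE⟩ := exists_finite_of_subset_insert fD₂ hD₂
    exact ⟨G₁ ∪ G₂, D₁ ∪ E, Set.union_subset hG₁ (hG₂.trans hΓ),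
      Set.union_subset hD₁ (hE.trans hΔ), fG₁.union fG₂, fD₁.union fE,
      .exElim Set.subset_union_right Set.subset_union_right (fun x hx => fΓ x (hG₂ hx))
        (fun x hx => fΔ x (hE hx)) hφ hψ
        (.weaken Set.subset_union_left Set.subset_union_left h₁) (.weaken subset_rfl hDE h₂)⟩

/-! ### The distributive lattice of a prime saturated theory

For a prime saturated theory `Γ` the sentences, preordered by `α → β ∈ Γ`, form a distributive
lattice in which `∀` and `∃` are infima and suprema over the closed terms. -/

namespace PST

variable {L : Signature} {Γ : Set (Formula L.plus)} {α β γ φ ψ χ : Formula L.plus}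

theorem sentence (hΓ : PST L Γ) (h : φ ∈ Γ) : φ.Sentence := hΓ.1 φ h

theorem mem_of_prvB (hΓ : PST L Γ) (hs : φ.Sentence) (h : PrvB L Γ φ) : φ ∈ Γ :=
  hΓ.2.2.1 φ hs h

theorem imp_mem (hΓ : PST L Γ) (hα : α.Sentence) (hβ : β.Sentence)
    (h : PrfN L 0 ∅ {α} β) : α.imp β ∈ Γ :=
  hΓ.mem_of_prvB ⟨hα, hβ⟩
    (.impIntro hα (.weaken (Set.empty_subset _) (Set.singleton_subset_iff.2 (.inl rfl)) h))

theorem imp_refl (hΓ : PST L Γ) (hα : α.Sentence) : α.imp α ∈ Γ :=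
  hΓ.imp_mem hα hα (.hyp (.inr rfl) hα)

theorem imp_trans (hΓ : PST L Γ) (h₁ : α.imp β ∈ Γ) (h₂ : β.imp γ ∈ Γ) : α.imp γ ∈ Γ :=
  hΓ.mem_of_prvB ⟨(hΓ.sentence h₁).1, (hΓ.sentence h₂).2⟩
    (.intTrans (.hyp (.inl h₁) (hΓ.sentence h₁)) (.hyp (.inl h₂) (hΓ.sentence h₂)))

theorem imp_of_prf (hΓ : PST L Γ) (h : α.imp φ ∈ Γ) (hχ : χ.Sentence)
    (hp : PrfN L 0 ∅ {φ} χ) : α.imp χ ∈ Γ :=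
  hΓ.imp_trans h (hΓ.imp_mem (hΓ.sentence h).2 hχ hp)

theorem imp_and (hΓ : PST L Γ) (h₁ : α.imp β ∈ Γ) (h₂ : α.imp γ ∈ Γ) :
    α.imp (β.and γ) ∈ Γ :=
  hΓ.mem_of_prvB ⟨(hΓ.sentence h₁).1, (hΓ.sentence h₁).2, (hΓ.sentence h₂).2⟩
    (.intAndIntro (.hyp (.inl h₁) (hΓ.sentence h₁)) (.hyp (.inl h₂) (hΓ.sentence h₂)))

theorem imp_of_prf₂ (hΓ : PST L Γ) (h₁ : α.imp φ ∈ Γ) (h₂ : α.imp ψ ∈ Γ) (hχ : χ.Sentence)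
    (hp : PrfN L 0 ∅ {φ.and ψ} φ → PrfN L 0 ∅ {φ.and ψ} ψ → PrfN L 0 ∅ {φ.and ψ} χ) :
    α.imp χ ∈ Γ :=
  have h := hΓ.imp_and h₁ h₂
  have hh : PrfN L 0 ∅ {φ.and ψ} (φ.and ψ) := .hyp (.inr rfl) (hΓ.sentence h).2
  hΓ.imp_of_prf h hχ (hp hh.andElimL hh.andElimR)

theorem and_imp_left (hΓ : PST L Γ) (hα : α.Sentence) (hβ : β.Sentence) :
    (α.and β).imp α ∈ Γ :=
  hΓ.imp_mem ⟨hα, hβ⟩ hα (.andElimL (.hyp (.inr rfl) ⟨hα, hβ⟩))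

theorem and_imp_right (hΓ : PST L Γ) (hα : α.Sentence) (hβ : β.Sentence) :
    (α.and β).imp β ∈ Γ :=
  hΓ.imp_mem ⟨hα, hβ⟩ hβ (.andElimR (.hyp (.inr rfl) ⟨hα, hβ⟩))

theorem imp_or_left (hΓ : PST L Γ) (hα : α.Sentence) (hβ : β.Sentence) :
    α.imp (α.or β) ∈ Γ :=
  hΓ.imp_mem hα ⟨hα, hβ⟩ (.orIntroL hβ (.hyp (.inr rfl) hα))

theorem imp_or_right (hΓ : PST L Γ) (hα : α.Sentence) (hβ : β.Sentence) :
    β.imp (α.or β) ∈ Γ :=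
  hΓ.imp_mem hβ ⟨hα, hβ⟩ (.orIntroR hα (.hyp (.inr rfl) hβ))

theorem or_imp (hΓ : PST L Γ) (h₁ : α.imp γ ∈ Γ) (h₂ : β.imp γ ∈ Γ) : (α.or β).imp γ ∈ Γ :=
  hΓ.mem_of_prvB ⟨⟨(hΓ.sentence h₁).1, (hΓ.sentence h₂).1⟩, (hΓ.sentence h₁).2⟩
    (.intOrElim (.hyp (.inl h₁) (hΓ.sentence h₁)) (.hyp (.inl h₂) (hΓ.sentence h₂)))

theorem imp_of_imp_or (hΓ : PST L Γ) (h : α.imp (φ.or ψ) ∈ Γ) (h₁ : (α.and φ).imp χ ∈ Γ)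
    (h₂ : (α.and ψ).imp χ ∈ Γ) : α.imp χ ∈ Γ := by
  obtain ⟨hα, hφ, hψ⟩ : α.Sentence ∧ φ.Sentence ∧ ψ.Sentence := hΓ.sentence h
  have hαφ : (α.and φ).Sentence := ⟨hα, hφ⟩
  have hαψ : (α.and ψ).Sentence := ⟨hα, hψ⟩
  have hd : α.imp ((α.and φ).or (α.and ψ)) ∈ Γ :=
    hΓ.imp_of_prf₂ (hΓ.imp_refl hα) h ⟨hαφ, hαψ⟩ fun k₁ k₂ =>
      .orElim k₂
        (.orIntroL hαψ (.andIntro (.weaken subset_rfl (Set.subset_insert _ _) k₁)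
          (.hyp (.inr (.inl rfl)) hφ)))
        (.orIntroR hαφ (.andIntro (.weaken subset_rfl (Set.subset_insert _ _) k₁)
          (.hyp (.inr (.inl rfl)) hψ)))
  exact hΓ.imp_trans hd (hΓ.or_imp h₁ h₂)

theorem imp_imp (hΓ : PST L Γ) (h : (α.and φ).imp ψ ∈ Γ) : α.imp (φ.imp ψ) ∈ Γ := by
  obtain ⟨⟨hα, hφ⟩, hψ⟩ : (α.Sentence ∧ φ.Sentence) ∧ ψ.Sentence := hΓ.sentence h
  exact hΓ.mem_of_prvB ⟨hα, hφ, hψ⟩ (.impIntro hα (.intTrans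
    (.impIntro hφ (.andIntro (.hyp (.inr (.inr (.inl rfl))) hα) (.hyp (.inr (.inl rfl)) hφ)))
    (.hyp (.inl h) (hΓ.sentence h))))

theorem imp_all (hΓ : PST L Γ) (hα : α.Sentence) (hφ : φ.ClosedAt 1)
    (h : ∀ t : Term L.plus, t.Closed → α.imp (subst0 φ t) ∈ Γ) : α.imp φ.all ∈ Γ := by
  have hall : (α.imp φ).all ∈ Γ := by
    refine hΓ.2.2.2.2.2 _ ⟨?_, hφ⟩ fun t ht => ?_
    · exact closedAt_one_of_subst0 (t := aconst L 0) (by rwa [hα.subst0_eq_self])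
    · change (subst0 α t).imp (subst0 φ t) ∈ Γ
      rw [hα.subst0_eq_self]
      exact h t ht
  exact hΓ.mem_of_prvB ⟨hα, hφ⟩ (.intAllIntro hα (.hyp (.inl hall) (hΓ.sentence hall)))

theorem ex_imp (hΓ : PST L Γ) (hα : α.Sentence) (hφ : φ.ClosedAt 1)
    (h : ∀ t : Term L.plus, t.Closed → (subst0 φ t).imp α ∈ Γ) : φ.ex.imp α ∈ Γ := by
  have hall : (φ.imp α).all ∈ Γ := by
    refine hΓ.2.2.2.2.2 _ ⟨hφ, ?_⟩ fun t ht => ?_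
    · exact closedAt_one_of_subst0 (t := aconst L 0) (by rwa [hα.subst0_eq_self])
    · change (subst0 φ t).imp (subst0 α t) ∈ Γ
      rw [hα.subst0_eq_self]
      exact h t ht
  exact hΓ.mem_of_prvB ⟨hφ, hα⟩ (.intExElim hα (.hyp (.inl hall) (hΓ.sentence hall)))

theorem all_imp_subst0 (hΓ : PST L Γ) (hφ : φ.ClosedAt 1) {t : Term L.plus} (ht : t.Closed) :
    φ.all.imp (subst0 φ t) ∈ Γ :=
  hΓ.imp_mem hφ (sentence_subst0 hφ ht) (.allElim ht (.hyp (.inr rfl) hφ))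

theorem subst0_imp_ex (hΓ : PST L Γ) (hφ : φ.ClosedAt 1) {t : Term L.plus} (ht : t.Closed) :
    (subst0 φ t).imp φ.ex ∈ Γ :=
  hΓ.imp_mem (sentence_subst0 hφ ht) hφ
    (.exIntro ht hφ (.hyp (.inr rfl) (sentence_subst0 hφ ht)))

theorem imp_or_all (hΓ : PST L Γ) (hα : α.Sentence) (hβ : β.Sentence) (hφ : φ.ClosedAt 1)
    (h : ∀ t : Term L.plus, t.Closed → α.imp (β.or (subst0 φ t)) ∈ Γ) :
    α.imp (β.or φ.all) ∈ Γ := by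
  have hβ' : β.ClosedAt 1 :=
    closedAt_one_of_subst0 (t := aconst L 0) (by rwa [hβ.subst0_eq_self])
  have hall : α.imp (β.or φ).all ∈ Γ := by
    refine hΓ.imp_all hα ⟨hβ', hφ⟩ fun t ht => ?_
    change α.imp ((subst0 β t).or (subst0 φ t)) ∈ Γ
    rw [hβ.subst0_eq_self]
    exact h t ht
  exact hΓ.imp_of_prf hall ⟨hβ, hφ⟩ (.cd hβ (.hyp (.inr rfl) ⟨hβ', hφ⟩))

theorem and_ex_imp (hΓ : PST L Γ) (hα : α.Sentence) (hβ : β.Sentence) (hφ : φ.ClosedAt 1)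
    (h : ∀ t : Term L.plus, t.Closed → (α.and (subst0 φ t)).imp β ∈ Γ) :
    (α.and φ.ex).imp β ∈ Γ := by
  have hα' : α.ClosedAt 1 :=
    closedAt_one_of_subst0 (t := aconst L 0) (by rwa [hα.subst0_eq_self])
  have hsub (t : Term L.plus) : subst0 (α.and φ) t = α.and (subst0 φ t) := by
    change (subst0 α t).and (subst0 φ t) = _
    rw [hα.subst0_eq_self]
  have hex : (α.and φ).ex.imp β ∈ Γ :=
    hΓ.ex_imp hβ ⟨hα', hφ⟩ fun t ht => by
      rw [hsub]
      exact h t ht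
  have hs : (α.and φ.ex).Sentence := ⟨hα, hφ⟩
  obtain ⟨i, hiα, hiφ⟩ := exists_fresh α φ
  refine hΓ.imp_trans (hΓ.imp_mem hs (hΓ.sentence hex).1 ?_) hex
  refine .exElim (i := i) subset_rfl subset_rfl (fun _ h => h.elim) ?_ hiφ ?_
    (.andElimR (.hyp (.inr rfl) hs)) ?_
  · rintro _ rfl (h | h)
    exacts [hiα h, hiφ h]
  · rintro (h | h)
    exacts [hiα h, hiφ h]
  · refine .exIntro (t := aconst L i) trivial ⟨hα', hφ⟩ ?_
    rw [hsub]
    exact .andIntro (.andElimL (.hyp (.inr (.inr rfl)) hs))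
      (.hyp (.inr (.inl rfl)) (sentence_subst0 hφ trivial))

theorem imp_of_imp_ex (hΓ : PST L Γ) (hβ : β.Sentence) (h : α.imp φ.ex ∈ Γ)
    (hφ : ∀ t : Term L.plus, t.Closed → (α.and (subst0 φ t)).imp β ∈ Γ) : α.imp β ∈ Γ :=
  have hs : α.Sentence ∧ φ.ClosedAt 1 := hΓ.sentence h
  hΓ.imp_trans (hΓ.imp_and (hΓ.imp_refl hs.1) h) (hΓ.and_ex_imp hs.1 hβ hs.2 hφ)

/-- Soundness of `NBQL_CD` in the lattice of `Γ`, under every replacement of constants by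
closed terms. -/
theorem imp_of_prfN_zero (hΓ : PST L Γ) {n : ℕ} {G D : Set (Formula L.plus)}
    (hp : PrfN L n G D χ) (hn : n = 0) (σ : L.plus.Const → Term L.plus)
    (hσ : ∀ c, (σ c).Closed) (hα : α.Sentence)
    (hG : ∀ γ ∈ G ∪ D, α.imp (γ.replC σ) ∈ Γ) : α.imp (χ.replC σ) ∈ Γ := by
  have ins {G D : Set (Formula L.plus)} {α φ : Formula L.plus} {σ : L.plus.Const → Term L.plus}
      (hα : α.Sentence) (hφ : (φ.replC σ).Sentence)
      (hG : ∀ γ ∈ G ∪ D, α.imp (γ.replC σ) ∈ Γ) :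
      ∀ γ ∈ G ∪ insert φ D, (α.and (φ.replC σ)).imp (γ.replC σ) ∈ Γ := by
    rintro γ (h | rfl | h)
    · exact hΓ.imp_trans (hΓ.and_imp_left hα hφ) (hG γ (.inl h))
    · exact hΓ.and_imp_right hα hφ
    · exact hΓ.imp_trans (hΓ.and_imp_left hα hφ) (hG γ (.inr h))
  induction hp generalizing α σ with
  | hyp h _ => exact hG _ h
  | weaken h₁ h₂ _ ih =>
    exact ih hn σ hσ hα fun γ hγ => hG γ (Set.union_subset_union h₁ h₂ hγ)
  | topIntro => exact hΓ.imp_mem hα trivial .topIntro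
  | botElim hs _ ih =>
    have hs' := Formula.ClosedAt.replC hs hσ
    exact hΓ.imp_of_prf (ih hn σ hσ hα hG) hs' (.botElim hs' (.hyp (.inr rfl) trivial))
  | andIntro _ _ ih₁ ih₂ => exact hΓ.imp_and (ih₁ hn σ hσ hα hG) (ih₂ hn σ hσ hα hG)
  | andElimL _ ih =>
    have h := ih hn σ hσ hα hG
    have hs := (hΓ.sentence h).2
    exact hΓ.imp_trans h (hΓ.and_imp_left hs.1 hs.2)
  | andElimR _ ih =>
    have h := ih hn σ hσ hα hG
    have hs := (hΓ.sentence h).2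
    exact hΓ.imp_trans h (hΓ.and_imp_right hs.1 hs.2)
  | orIntroL hs _ ih =>
    have h := ih hn σ hσ hα hG
    exact hΓ.imp_trans h (hΓ.imp_or_left (hΓ.sentence h).2 (Formula.ClosedAt.replC hs hσ))
  | orIntroR hs _ ih =>
    have h := ih hn σ hσ hα hG
    exact hΓ.imp_trans h (hΓ.imp_or_right (Formula.ClosedAt.replC hs hσ) (hΓ.sentence h).2)
  | orElim _ _ _ ih₁ ih₂ ih₃ =>
    have h := ih₁ hn σ hσ hα hG
    have hs := (hΓ.sentence h).2
    exact hΓ.imp_of_imp_or h (ih₂ hn σ hσ ⟨hα, hs.1⟩ (ins hα hs.1 hG))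
      (ih₃ hn σ hσ ⟨hα, hs.2⟩ (ins hα hs.2 hG))
  | impIntro hs _ ih =>
    have hs' := Formula.ClosedAt.replC hs hσ
    exact hΓ.imp_imp (ih hn σ hσ ⟨hα, hs'⟩ (ins hα hs' hG))
  | impElim hm => omega
  | intTrans _ _ ih₁ ih₂ =>
    have h₁ := ih₁ hn σ hσ hα hG
    have h₂ := ih₂ hn σ hσ hα hG
    exact hΓ.imp_of_prf₂ h₁ h₂ ⟨(hΓ.sentence h₁).2.1, (hΓ.sentence h₂).2.2⟩ .intTrans
  | intAndIntro _ _ ih₁ ih₂ =>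
    have h₁ := ih₁ hn σ hσ hα hG
    have h₂ := ih₂ hn σ hσ hα hG
    exact hΓ.imp_of_prf₂ h₁ h₂
      ⟨(hΓ.sentence h₁).2.1, (hΓ.sentence h₁).2.2, (hΓ.sentence h₂).2.2⟩ .intAndIntro
  | intOrElim _ _ ih₁ ih₂ =>
    have h₁ := ih₁ hn σ hσ hα hG
    have h₂ := ih₂ hn σ hσ hα hG
    exact hΓ.imp_of_prf₂ h₁ h₂
      ⟨⟨(hΓ.sentence h₁).2.1, (hΓ.sentence h₂).2.1⟩, (hΓ.sentence h₁).2.2⟩ .intOrElim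
  | intAllIntro hs _ ih =>
    have h := ih hn σ hσ hα hG
    have hs' := Formula.ClosedAt.replC hs hσ
    have hall := (hΓ.sentence h).2
    exact hΓ.imp_of_prf h ⟨hs', hall.2⟩ (.intAllIntro hs' (.hyp (.inr rfl) hall))
  | intExElim hs _ ih =>
    have h := ih hn σ hσ hα hG
    have hs' := Formula.ClosedAt.replC hs hσ
    have hall := (hΓ.sentence h).2
    exact hΓ.imp_of_prf h ⟨hall.1, hs'⟩ (.intExElim hs' (.hyp (.inr rfl) hall))
  | @allIntro _ _ _ _ _ φ i h₁ h₂ f₁ f₂ hi _ ih =>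
    have key (t : Term L.plus) (ht : t.Closed) : α.imp (subst0 (φ.replC σ) t) ∈ Γ := by
      obtain ⟨τ, hτ, heq, hsub⟩ := exists_replC_update hσ ht i
      rw [← hsub φ hi]
      refine ih hn τ hτ hα fun γ hγ => ?_
      rw [heq γ (hγ.elim (f₁ γ) (f₂ γ))]
      exact hG γ (Set.union_subset_union h₁ h₂ hγ)
    exact hΓ.imp_all hα
      (closedAt_one_of_subst0 (hΓ.sentence (key (aconst L 0) trivial)).2) key
  | allElim ht _ ih =>
    have h := ih hn σ hσ hα hG
    rw [replC_subst0 hσ]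
    exact hΓ.imp_trans h (hΓ.all_imp_subst0 (hΓ.sentence h).2 (Term.ClosedAt.replC ht hσ))
  | cd hs _ ih =>
    have h := ih hn σ hσ hα hG
    have hs' := Formula.ClosedAt.replC hs hσ
    have hall := (hΓ.sentence h).2
    exact hΓ.imp_of_prf h ⟨hs', hall.2⟩ (.cd hs' (.hyp (.inr rfl) hall))
  | exIntro ht hs _ ih =>
    have h := ih hn σ hσ hα hG
    rw [replC_subst0 hσ] at h
    exact hΓ.imp_trans h
      (hΓ.subst0_imp_ex (Formula.ClosedAt.replC hs hσ) (Term.ClosedAt.replC ht hσ))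
  | @exElim _ _ _ _ _ φ ψ i h₁ h₂ f₁ f₂ hi hj _ _ ih₁ ih₂ =>
    have h := ih₁ hn σ hσ hα hG
    have key (t : Term L.plus) (ht : t.Closed) :
        (α.and (subst0 (φ.replC σ) t)).imp (ψ.replC σ) ∈ Γ := by
      have hs := sentence_subst0 (hΓ.sentence h).2 ht
      obtain ⟨τ, hτ, heq, hsub⟩ := exists_replC_update hσ ht i
      rw [← hsub φ hi] at hs ⊢
      rw [← heq ψ hj]
      refine ih₂ hn τ hτ ⟨hα, hs⟩ (ins hα hs fun γ hγ => ?_)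
      rw [heq γ (hγ.elim (f₁ γ) (f₂ γ))]
      exact hG γ (Set.union_subset_union h₁ h₂ hγ)
    exact hΓ.imp_of_imp_ex (hΓ.sentence (key (aconst L 0) trivial)).2 h key

theorem imp_of_prvB (hΓ : PST L Γ) {G : Set (Formula L.plus)} (hp : PrvB L G χ)
    (hα : α.Sentence) (hG : ∀ γ ∈ G, α.imp γ ∈ Γ) : α.imp χ ∈ Γ := by
  have h := hΓ.imp_of_prfN_zero hp rfl .const (fun _ => trivial) hα fun γ hγ => by
    rw [γ.replC_const]
    exact hG γ (hγ.resolve_right id)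
  rwa [χ.replC_const] at h

/-! ### Construction of the extension -/

/-- Separated pairs of sentences can be refined so as to decide a given sentence, providing a
witness if it is existential and accepted, or universal and rejected. -/
theorem exists_refinement (hΓ : PST L Γ) (hα : α.Sentence) (hβ : β.Sentence)
    (h : α.imp β ∉ Γ) (hχ : χ.Sentence) :
    ∃ α' β' : Formula L.plus, α'.imp β' ∉ Γ ∧ α'.imp α ∈ Γ ∧ β.imp β' ∈ Γ ∧
      ((α'.imp χ ∈ Γ ∧ ∀ φ, χ = .ex φ → ∃ t : Term L.plus, t.Closed ∧ α'.imp (subst0 φ t) ∈ Γ) ∨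
       (χ.imp β' ∈ Γ ∧
        ∀ φ, χ = .all φ → ∃ t : Term L.plus, t.Closed ∧ (subst0 φ t).imp β' ∈ Γ)) := by
  by_cases hl : (α.and χ).imp β ∈ Γ
  · have hr : α.imp (β.or χ) ∉ Γ := fun hr =>
      h (hΓ.imp_of_imp_or hr (hΓ.and_imp_right hα hβ) hl)
    by_cases hall : ∃ φ, χ = .all φ
    · obtain ⟨φ, rfl⟩ := hall
      obtain ⟨t, ht, hαt⟩ : ∃ t : Term L.plus, t.Closed ∧ α.imp (β.or (subst0 φ t)) ∉ Γ := by
        by_contra! hc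
        exact hr (hΓ.imp_or_all hα hβ hχ hc)
      have hs := sentence_subst0 hχ ht
      have hor := hΓ.imp_or_right hβ hs
      refine ⟨α, β.or (subst0 φ t), hαt, hΓ.imp_refl hα, hΓ.imp_or_left hβ hs,
        .inr ⟨hΓ.imp_trans (hΓ.all_imp_subst0 hχ ht) hor, ?_⟩⟩
      rintro _ ⟨⟩
      exact ⟨t, ht, hor⟩
    · exact ⟨α, β.or χ, hr, hΓ.imp_refl hα, hΓ.imp_or_left hβ hχ,
        .inr ⟨hΓ.imp_or_right hβ hχ, fun φ hφ => absurd ⟨φ, hφ⟩ hall⟩⟩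
  · by_cases hex : ∃ φ, χ = .ex φ
    · obtain ⟨φ, rfl⟩ := hex
      obtain ⟨t, ht, hαt⟩ : ∃ t : Term L.plus, t.Closed ∧ (α.and (subst0 φ t)).imp β ∉ Γ := by
        by_contra! hc
        exact hl (hΓ.and_ex_imp hα hβ hχ hc)
      have hs := sentence_subst0 hχ ht
      have hand := hΓ.and_imp_right hα hs
      refine ⟨α.and (subst0 φ t), β, hαt, hΓ.and_imp_left hα hs, hΓ.imp_refl hβ,
        .inl ⟨hΓ.imp_trans hand (hΓ.subst0_imp_ex hχ ht), ?_⟩⟩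
      rintro _ ⟨⟩
      exact ⟨t, ht, hand⟩
    · exact ⟨α.and χ, β, hl, hΓ.and_imp_left hα hχ, hΓ.imp_refl hβ,
        .inl ⟨hΓ.and_imp_right hα hχ, fun φ hφ => absurd ⟨φ, hφ⟩ hex⟩⟩

/-- A descending sequence `a` and an ascending sequence `b` of sentences, termwise separated,
which decide every sentence with witnesses, give a prime saturated theory above `Γ`. -/
theorem of_separated (hΓ : PST L Γ) {a b : ℕ → Formula L.plus}
    (hab : ∀ n, (a n).imp (b n) ∉ Γ) (ha : ∀ m n, m ≤ n → (a n).imp (a m) ∈ Γ)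
    (hb : ∀ m n, m ≤ n → (b m).imp (b n) ∈ Γ)
    (hdec : ∀ χ : Formula L.plus, χ.Sentence → ∃ n,
      ((a n).imp χ ∈ Γ ∧
        ∀ φ, χ = .ex φ → ∃ t : Term L.plus, t.Closed ∧ (a n).imp (subst0 φ t) ∈ Γ) ∨
      (χ.imp (b n) ∈ Γ ∧
        ∀ φ, χ = .all φ → ∃ t : Term L.plus, t.Closed ∧ (subst0 φ t).imp (b n) ∈ Γ)) :
    PST L {χ | ∃ n, (a n).imp χ ∈ Γ} ∧ canAcc L Γ {χ | ∃ n, (a n).imp χ ∈ Γ} := by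
  have hsa (n : ℕ) : (a n).Sentence := (hΓ.sentence (ha n n le_rfl)).1
  have hsb (n : ℕ) : (b n).Sentence := (hΓ.sentence (hb n n le_rfl)).1
  have hsep {m n : ℕ} {χ : Formula L.plus} (h₁ : (a m).imp χ ∈ Γ) : χ.imp (b n) ∉ Γ := fun h₂ =>
    hab (max m n) (hΓ.imp_trans (ha _ _ (le_max_left m n))
      (hΓ.imp_trans h₁ (hΓ.imp_trans h₂ (hb _ _ (le_max_right m n)))))
  refine ⟨⟨?_, ?_, ?_, ?_, ?_, ?_⟩, ?_⟩
  · rintro χ ⟨n, h⟩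
    exact (hΓ.sentence h).2
  · rintro ⟨n, h⟩
    exact hsep (n := 0) h (hΓ.imp_mem trivial (hsb 0) (.botElim (hsb 0) (.hyp (.inr rfl) trivial)))
  · intro χ _ hp
    obtain ⟨G, D, hG, hD, fG, -, hp⟩ := PrfN.exists_finite hp
    obtain rfl := Set.subset_empty_iff.1 hD
    choose! f hf using hG
    obtain ⟨N, hN⟩ := (fG.image f).bddAbove
    exact ⟨N, hΓ.imp_of_prvB hp (hsa N) fun γ hγ =>
      hΓ.imp_trans (ha _ _ (hN (Set.mem_image_of_mem f hγ))) (hf hγ)⟩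
  · rintro φ ψ ⟨k, h⟩
    have hs := (hΓ.sentence h).2
    obtain ⟨m, ⟨hm, -⟩ | ⟨hm, -⟩⟩ := hdec φ hs.1
    · exact .inl ⟨m, hm⟩
    obtain ⟨n, ⟨hn, -⟩ | ⟨hn, -⟩⟩ := hdec ψ hs.2
    · exact .inr ⟨n, hn⟩
    exact absurd (hΓ.or_imp (hΓ.imp_trans hm (hb _ _ (le_max_left m n)))
      (hΓ.imp_trans hn (hb _ _ (le_max_right m n)))) (hsep h)
  · rintro φ ⟨k, h⟩
    obtain ⟨n, ⟨-, hn⟩ | ⟨hn, -⟩⟩ := hdec _ (hΓ.sentence h).2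
    · obtain ⟨t, ht, hφ⟩ := hn φ rfl
      exact ⟨t, ht, n, hφ⟩
    · exact absurd hn (hsep h)
  · intro φ hφ h
    obtain ⟨n, ⟨hn, -⟩ | ⟨-, hn⟩⟩ := hdec φ.all hφ
    · exact ⟨n, hn⟩
    · obtain ⟨t, ht, hn⟩ := hn φ rfl
      obtain ⟨m, hm⟩ := h t ht
      exact absurd hn (hsep hm)
  · rintro α β h ⟨n, hn⟩
    exact ⟨n, hΓ.imp_trans hn h⟩

end PST

/-- **Relative Extension** (Lemma 12): for a prime saturated `BQL_CD`-theory `Γ`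
(over a countable language): if `Γ ⊬_{[-1]} φ → ψ` then there is a prime saturated
`BQL_CD`-theory `Δ` such that `Γ ≺ Δ`, `φ ∈ Δ` and `ψ ∉ Δ`. -/
theorem relative_extension {L : Signature}
    [Countable L.Const] [Countable L.Func] [Countable L.Rel]
    (Γ : Set (Formula L.plus)) (hΓ : PST L Γ) (φ ψ : Formula L.plus)
    (hφ : φ.Sentence) (hψ : ψ.Sentence)
    (h : ¬ PrvB L Γ (.imp φ ψ)) :
    ∃ Δ : Set (Formula L.plus), PST L Δ ∧ canAcc L Γ Δ ∧ φ ∈ Δ ∧ ψ ∉ Δ := by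
  have hsep : φ.imp ψ ∉ Γ := fun hm => h (.hyp (.inl hm) ⟨hφ, hψ⟩)
  have : Nonempty {χ : Formula L.plus // χ.Sentence} := ⟨⟨φ, hφ⟩⟩
  obtain ⟨e, he⟩ := exists_surjective_nat {χ : Formula L.plus // χ.Sentence}
  let P := {p : Formula L.plus × Formula L.plus // (p.1.Sentence ∧ p.2.Sentence) ∧ p.1.imp p.2 ∉ Γ}
  have step (n : ℕ) (p : P) : ∃ q : P, q.1.1.imp p.1.1 ∈ Γ ∧ p.1.2.imp q.1.2 ∈ Γ ∧
      ((q.1.1.imp (e n).1 ∈ Γ ∧ ∀ φ, (e n).1 = .ex φ →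
          ∃ t : Term L.plus, t.Closed ∧ q.1.1.imp (subst0 φ t) ∈ Γ) ∨
       ((e n).1.imp q.1.2 ∈ Γ ∧ ∀ φ, (e n).1 = .all φ →
          ∃ t : Term L.plus, t.Closed ∧ (subst0 φ t).imp q.1.2 ∈ Γ)) := by
    obtain ⟨α, β, h₁, h₂, h₃, h₄⟩ := hΓ.exists_refinement p.2.1.1 p.2.1.2 p.2.2 (e n).2
    exact ⟨⟨(α, β), ⟨(hΓ.sentence h₂).1, (hΓ.sentence h₃).2⟩, h₁⟩, h₂, h₃, h₄⟩
  choose next hnext using step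
  let s : ℕ → P := fun n => Nat.rec ⟨(φ, ψ), ⟨hφ, hψ⟩, hsep⟩ next n
  have ha (m n : ℕ) (hmn : m ≤ n) : (s n).1.1.imp (s m).1.1 ∈ Γ := by
    induction hmn with
    | refl => exact hΓ.imp_refl (s m).2.1.1
    | step _ ih => exact hΓ.imp_trans (hnext _ (s _)).1 ih
  have hb (m n : ℕ) (hmn : m ≤ n) : (s m).1.2.imp (s n).1.2 ∈ Γ := by
    induction hmn with
    | refl => exact hΓ.imp_refl (s m).2.1.2
    | step _ ih => exact hΓ.imp_trans ih (hnext _ (s _)).2.1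
  obtain ⟨hΔ, hacc⟩ := hΓ.of_separated (a := fun n => (s n).1.1) (b := fun n => (s n).1.2)
    (fun n => (s n).2.2) ha hb fun χ hχ => by
      obtain ⟨n, hn⟩ := he ⟨χ, hχ⟩
      have := (hnext n (s n)).2.2
      rw [hn] at this
      exact ⟨n + 1, this⟩
  refine ⟨_, hΔ, hacc, ⟨0, hΓ.imp_refl hφ⟩, ?_⟩
  rintro ⟨n, hn⟩
  exact (s n).2.2 (hΓ.imp_trans hn (hb 0 n (Nat.zero_le n)))

end BQL
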